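/- arXiv:2010.00742 — 7 statements merged into one kernel-verified Lean document; each statement's English description precedes it below -/
import Mathlib

section
/- Let z>0 and let m be a Lévy measure on (0,∞). Then for all x,y∈[0,1], ∫_{(0,∞)} ∫_{[1,∞)} |g^{(z)}(x,w,v) − g^{(z)}(y,w,v)| m(dw) dv ≤ 3z·(∫_{[1,∞)} w/(z+w) m(dw))·|x−y|, and likewise ∫_{(0,∞)} ∫_{[1,∞)} |h^{(z)}(x,w,v) − h^{(z)}(y,w,v)| m(dw) dv ≤ 3z·(∫_{[1,∞)} w/(z+w) m(dw))·|x−y|. -/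
open MeasureTheory Set

theorem aux_le (z : ℝ) (hz : 0 < z) (a b : ℝ) (ha : 0 ≤ a) (hab : a ≤ b) (hb : b ≤ 1) :
    (∫ v in Ioi (0:ℝ), |(1 - a) * (if v ≤ a * z then (1:ℝ) else 0)
      - (1 - b) * (if v ≤ b * z then (1:ℝ) else 0)|) ≤ 3 * z * |a - b| := by
  have haz : a * z ≤ b * z := by gcongr
  have haz0 : 0 ≤ a * z := by positivity
  have hbz : b * z ≤ z := by nlinarith
  have i1 : Integrable ((Ioc 0 z).indicator (fun _ : ℝ => b - a)) (volume.restrict (Ioi 0)) := by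
    apply Integrable.restrict
    rw [integrable_indicator_iff measurableSet_Ioc]
    exact integrableOn_const (by simp)
  have i2 : Integrable ((Ioc (a * z) (b * z)).indicator (fun _ : ℝ => (1:ℝ)))
      (volume.restrict (Ioi 0)) := by
    apply Integrable.restrict
    rw [integrable_indicator_iff measurableSet_Ioc]
    exact integrableOn_const (by simp)
  have key : (∫ v in Ioi (0:ℝ), |(1 - a) * (if v ≤ a * z then (1:ℝ) else 0)
      - (1 - b) * (if v ≤ b * z then (1:ℝ) else 0)|) ≤
      ∫ v in Ioi (0:ℝ), ((Ioc 0 z).indicator (fun _ : ℝ => b - a) v +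
        (Ioc (a * z) (b * z)).indicator (fun _ : ℝ => (1:ℝ)) v) := by
    apply integral_mono_of_nonneg
    · exact Filter.Eventually.of_forall fun v => abs_nonneg _
    · exact i1.add i2
    · filter_upwards [ae_restrict_mem measurableSet_Ioi] with v hv
      have hv0 : 0 < v := hv
      simp only [indicator, mem_Ioc]
      rw [abs_le]
      by_cases h1 : v ≤ a * z
      · have h2 : v ≤ b * z := h1.trans haz
        have h3 : v ≤ z := h2.trans hbz
        simp [h1, h2, h3, hv0, not_lt.mpr h1]
        linarith
      · have h1' := not_le.mp h1
        by_cases h2 : v ≤ b * z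
        · have h3 : v ≤ z := h2.trans hbz
          simp [h1, h2, h3, hv0, h1']
          constructor <;> linarith
        · simp only [h1, h2, if_false, and_false]
          split_ifs <;> constructor <;> linarith
  refine key.trans ?_
  rw [integral_add i1 i2, integral_indicator measurableSet_Ioc, integral_indicator measurableSet_Ioc,
    Measure.restrict_restrict measurableSet_Ioc, Measure.restrict_restrict measurableSet_Ioc,
    inter_eq_left.mpr (fun v hv => hv.1), (inter_eq_left.mpr (fun v hv => haz0.trans_lt hv.1) :
      Ioc (a * z) (b * z) ∩ Ioi 0 = Ioc (a * z) (b * z))]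
  simp only [setIntegral_const, Measure.real, Real.volume_Ioc, smul_eq_mul]
  rw [ENNReal.toReal_ofReal (by linarith), ENNReal.toReal_ofReal (by linarith),
    abs_sub_comm, abs_of_nonneg (by linarith)]
  nlinarith [mul_nonneg hz.le (sub_nonneg.mpr hab)]

theorem aux_all (z : ℝ) (hz : 0 < z) (a b : ℝ) (ha : a ∈ Icc (0:ℝ) 1) (hb : b ∈ Icc (0:ℝ) 1) :
    (∫ v in Ioi (0:ℝ), |(1 - a) * (if v ≤ a * z then (1:ℝ) else 0)
      - (1 - b) * (if v ≤ b * z then (1:ℝ) else 0)|) ≤ 3 * z * |a - b| := by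
  rcases le_total a b with h | h
  · exact aux_le z hz a b ha.1 h hb.2
  · have := aux_le z hz b a hb.1 h ha.2
    rw [abs_sub_comm a b]
    simpa only [abs_sub_comm] using this

theorem aux_int (z : ℝ) (hz : 0 < z) (m : Measure ℝ) (k : ℝ → ℝ → ℝ) (c : ℝ → ℝ) (d : ℝ)
    (hk : ∀ v w, 1 ≤ w → k w v = w / (z + w) * c v)
    (hc : (∫ v in Ioi (0:ℝ), |c v|) ≤ 3 * z * d) :
    (∫ v in Ioi (0:ℝ), ∫ w in Ici (1:ℝ), |k w v| ∂m) ≤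
        3 * z * (∫ w in Ici (1:ℝ), w / (z + w) ∂m) * d := by
  have hI : 0 ≤ ∫ w in Ici (1:ℝ), w / (z + w) ∂m := by
    apply setIntegral_nonneg measurableSet_Ici
    intro w hw
    have : (1:ℝ) ≤ w := hw
    positivity
  have e : ∀ v, (∫ w in Ici (1:ℝ), |k w v| ∂m) = (∫ w in Ici (1:ℝ), w / (z + w) ∂m) * |c v| := by
    intro v
    rw [← integral_mul_const]
    apply setIntegral_congr_fun measurableSet_Ici
    intro w hw
    have hw' : (1:ℝ) ≤ w := hw
    simp only []
    rw [hk v w hw', abs_mul, abs_of_nonneg (by positivity)]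
  simp only [e]
  rw [integral_const_mul]
  calc _ ≤ (∫ w in Ici (1:ℝ), w / (z + w) ∂m) * (3 * z * d) := by gcongr
    _ = _ := by ring

/-- Lipschitz bound for the integrated large-jump coefficients of the
Λ-asymmetric frequency process. -/
theorem stmt3 (z : ℝ) (hz : 0 < z)
    (m : Measure ℝ)
    (hm : ∫⁻ w in Ioi (0:ℝ), ENNReal.ofReal (min 1 (w^2)) ∂m < ⊤)
    (g h : ℝ → ℝ → ℝ → ℝ)
    (hg : ∀ x w v, g x w v =
      (w / (z + w)) * (1 - x) * (if v ≤ x * z then (1:ℝ) else 0) *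
        (if 0 ≤ x ∧ x ≤ 1 then (1:ℝ) else 0))
    (hh : ∀ x w v, h x w v =
      -((w / (z + w)) * x * (if v ≤ (1 - x) * z then (1:ℝ) else 0) *
        (if 0 ≤ x ∧ x ≤ 1 then (1:ℝ) else 0))) :
    ∀ x ∈ Icc (0:ℝ) 1, ∀ y ∈ Icc (0:ℝ) 1,
      (∫ v in Ioi (0:ℝ), ∫ w in Ici (1:ℝ), |g x w v - g y w v| ∂m) ≤
        3 * z * (∫ w in Ici (1:ℝ), w / (z + w) ∂m) * |x - y| ∧
      (∫ v in Ioi (0:ℝ), ∫ w in Ici (1:ℝ), |h x w v - h y w v| ∂m) ≤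
        3 * z * (∫ w in Ici (1:ℝ), w / (z + w) ∂m) * |x - y| := by
  intro x hx y hy
  have hx' : 0 ≤ x ∧ x ≤ 1 := hx
  have hy' : 0 ≤ y ∧ y ≤ 1 := hy
  constructor
  · refine aux_int z hz m (fun w v => g x w v - g y w v) _ _ ?_ (aux_all z hz x y hx hy)
    intro v w _
    simp only [hg, if_pos hx', if_pos hy']
    ring
  · have := aux_all z hz (1 - y) (1 - x) ⟨by linarith, by linarith⟩ ⟨by linarith, by linarith⟩
    rw [show (1 - y) - (1 - x) = x - y by ring] at this
    refine aux_int z hz m (fun w v => h x w v - h y w v) _ _ ?_ this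
    intro v w _
    simp only [hh, if_pos hx', if_pos hy']
    ring
end

section
/- Let z>0 and let m be a Lévy measure on (0,∞). Then for all x,y∈[0,1], ∫_{(0,∞)} ∫_{(0,∞)} |g^{(z)}(x,w,v) − g^{(z)}(y,w,v)|² m(dw) dv ≤ 9z·(∫_{(0,∞)} w²/(z+w)² m(dw))·|x−y|, and likewise ∫_{(0,∞)} ∫_{(0,∞)} |h^{(z)}(x,w,v) − h^{(z)}(y,w,v)|² m(dw) dv ≤ 9z·(∫_{(0,∞)} w²/(z+w)² m(dw))·|x−y|. -/
open MeasureTheory Set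

lemma scalar_bound (z : ℝ) (hz : 0 < z) (x y : ℝ) (hx : x ∈ Icc (0:ℝ) 1) (hy : y ∈ Icc (0:ℝ) 1) :
    ∫ v in Ioi (0:ℝ), ((1 - x) * (if v ≤ x * z then (1:ℝ) else 0)
      - (1 - y) * (if v ≤ y * z then (1:ℝ) else 0)) ^ 2 ≤ 9 * z * |x - y| := by
  wlog hxy : x ≤ y generalizing x y
  · have h := this y x hy hx (by linarith)
    rw [abs_sub_comm]
    refine le_trans (le_of_eq ?_) h
    congr 1
    ext v
    ring
  obtain ⟨hx0, hx1⟩ := hx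
  obtain ⟨hy0, hy1⟩ := hy
  have hxz : x * z ≤ y * z := by gcongr
  have hx0z : 0 ≤ x * z := by positivity
  have hyz : y * z ≤ z := by nlinarith
  have i1 : Integrable ((Ioc 0 z).indicator (fun _ : ℝ => (x - y) ^ 2)) volume :=
    (integrable_indicator_iff measurableSet_Ioc).2 (by simp [IntegrableOn])
  have i2 : Integrable ((Ioc (x * z) (y * z)).indicator (fun _ : ℝ => (1:ℝ))) volume :=
    (integrable_indicator_iff measurableSet_Ioc).2 (by simp [IntegrableOn])
  have hb : ∫ v in Ioi (0:ℝ), ((1 - x) * (if v ≤ x * z then (1:ℝ) else 0)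
      - (1 - y) * (if v ≤ y * z then (1:ℝ) else 0)) ^ 2 ≤
      ∫ v in Ioi (0:ℝ), ((Ioc 0 z).indicator (fun _ : ℝ => (x - y) ^ 2) v
        + (Ioc (x * z) (y * z)).indicator (fun _ : ℝ => (1:ℝ)) v) := by
    apply integral_mono_of_nonneg
    · exact Filter.Eventually.of_forall fun v => sq_nonneg _
    · exact (i1.add i2).integrableOn
    · filter_upwards [ae_restrict_mem measurableSet_Ioi] with v hv
      have hv : 0 < v := hv
      simp only [indicator_apply, mem_Ioc]
      split_ifs <;> first | grind | nlinarith
  refine hb.trans ?_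
  rw [integral_add i1.integrableOn i2.integrableOn,
    setIntegral_indicator measurableSet_Ioc, setIntegral_indicator measurableSet_Ioc,
    inter_eq_right.2 (fun v hv => hv.1),
    inter_eq_right.2 (show Ioc (x * z) (y * z) ⊆ Ioi 0 from fun v hv => lt_of_le_of_lt hx0z hv.1)]
  rw [abs_of_nonpos (by linarith)]
  simp only [setIntegral_const, Measure.real, Real.volume_Ioc, smul_eq_mul]
  rw [ENNReal.toReal_ofReal (by linarith), ENNReal.toReal_ofReal (by linarith)]
  have : (x - y) ^ 2 ≤ y - x := by nlinarith
  nlinarith [mul_le_mul_of_nonneg_left this hz.le, mul_nonneg hz.le (sub_nonneg.2 hxy)]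

lemma full_bound (z : ℝ) (hz : 0 < z) (m : Measure ℝ) (x y : ℝ) (f : ℝ → ℝ → ℝ)
    (hx : x ∈ Icc (0:ℝ) 1) (hy : y ∈ Icc (0:ℝ) 1)
    (hf : ∀ w v, f w v = w ^ 2 / (z + w) ^ 2 * ((1 - x) * (if v ≤ x * z then (1:ℝ) else 0)
      - (1 - y) * (if v ≤ y * z then (1:ℝ) else 0)) ^ 2) :
    (∫ v in Ioi (0:ℝ), ∫ w in Ioi (0:ℝ), f w v ∂m) ≤
        9 * z * (∫ w in Ioi (0:ℝ), w ^ 2 / (z + w) ^ 2 ∂m) * |x - y| := by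
  simp only [hf, integral_mul_const, integral_const_mul]
  have hK : 0 ≤ ∫ w in Ioi (0:ℝ), w ^ 2 / (z + w) ^ 2 ∂m :=
    integral_nonneg fun w => by positivity
  refine (mul_le_mul_of_nonneg_left (scalar_bound z hz x y hx hy) hK).trans (le_of_eq ?_)
  ring

/-- Quadratic Lipschitz bound for the integrated small-jump coefficients of the
Λ-asymmetric frequency process. -/
theorem stmt4 (z : ℝ) (hz : 0 < z)
    (m : Measure ℝ)
    (hm : ∫⁻ w in Ioi (0:ℝ), ENNReal.ofReal (min 1 (w^2)) ∂m < ⊤)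
    (g h : ℝ → ℝ → ℝ → ℝ)
    (hg : ∀ x w v, g x w v =
      (w / (z + w)) * (1 - x) * (if v ≤ x * z then (1:ℝ) else 0) *
        (if 0 ≤ x ∧ x ≤ 1 then (1:ℝ) else 0))
    (hh : ∀ x w v, h x w v =
      -((w / (z + w)) * x * (if v ≤ (1 - x) * z then (1:ℝ) else 0) *
        (if 0 ≤ x ∧ x ≤ 1 then (1:ℝ) else 0))) :
    ∀ x ∈ Icc (0:ℝ) 1, ∀ y ∈ Icc (0:ℝ) 1,
      (∫ v in Ioi (0:ℝ), ∫ w in Ioi (0:ℝ), |g x w v - g y w v| ^ 2 ∂m) ≤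
        9 * z * (∫ w in Ioi (0:ℝ), w ^ 2 / (z + w) ^ 2 ∂m) * |x - y| ∧
      (∫ v in Ioi (0:ℝ), ∫ w in Ioi (0:ℝ), |h x w v - h y w v| ^ 2 ∂m) ≤
        9 * z * (∫ w in Ioi (0:ℝ), w ^ 2 / (z + w) ^ 2 ∂m) * |x - y| := by
  intro x hx y hy
  constructor
  · refine full_bound z hz m x y _ hx hy fun w v => ?_
    rw [sq_abs, hg, hg, if_pos (show 0 ≤ x ∧ x ≤ 1 from hx), if_pos (show 0 ≤ y ∧ y ≤ 1 from hy),
      ← div_pow]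
    ring
  · have e : |x - y| = |(1 - x) - (1 - y)| := by rw [abs_sub_comm]; congr 1; ring
    rw [e]
    refine full_bound z hz m (1 - x) (1 - y) _ ⟨by linarith [hx.2], by linarith [hx.1]⟩
      ⟨by linarith [hy.2], by linarith [hy.1]⟩ fun w v => ?_
    rw [sq_abs, hh, hh, if_pos (show 0 ≤ x ∧ x ≤ 1 from hx), if_pos (show 0 ≤ y ∧ y ≤ 1 from hy),
      ← div_pow]
    ring
end

section
/- Let z,v₁,v₂>0 and y₁,y₂∈(0,1). For every integer n ≥ 1 and every r∈[0,1]: z v₁ r·[(r+y₁(1−r))^n − r^n] + z v₂ (1−r)·[(r−y₂ r)^n − r^n] = z v₁ · Σ_{k=2}^{n} C(n,k) (1−y₁)^{n−k} y₁^{k} (r^{n−k+1} − r^n) + z·[ v₂(1−(1−y₂)^n) − v₁(1−(1−y₁)^n) ]·(r^{n+1} − r^n), where C(n,k) denotes the binomial coefficient. -/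
open Finset

theorem stmt10_aux (y r : ℝ) (n : ℕ) (hn : 1 ≤ n) :
    (∑ k ∈ Finset.Icc 2 n,
        (n.choose k : ℝ) * (1 - y) ^ (n - k) * y ^ k * (r ^ (n - k + 1) - r ^ n)) =
      r * (r + y * (1 - r)) ^ n - r ^ n - (1 - y) ^ n * (r ^ (n + 1) - r ^ n) := by
  have h1 : (y + r * (1 - y)) ^ n = ∑ k ∈ Finset.range (n + 1),
      y ^ k * (r * (1 - y)) ^ (n - k) * (n.choose k : ℝ) := add_pow _ _ _
  have h2 : (y + (1 - y)) ^ n = ∑ k ∈ Finset.range (n + 1),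
      y ^ k * (1 - y) ^ (n - k) * (n.choose k : ℝ) := add_pow _ _ _
  have h3 : (∑ k ∈ Finset.range (n + 1),
      (n.choose k : ℝ) * (1 - y) ^ (n - k) * y ^ k * (r ^ (n - k + 1) - r ^ n)) =
      r * (y + r * (1 - y)) ^ n - r ^ n * (y + (1 - y)) ^ n := by
    rw [h1, h2, Finset.mul_sum, Finset.mul_sum, ← Finset.sum_sub_distrib]
    refine Finset.sum_congr rfl fun k _ => ?_
    rw [mul_pow]
    ring
  have h4 : Finset.range (n + 1) = insert 0 (insert 1 (Finset.Icc 2 n)) := by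
    ext k
    simp only [Finset.mem_range, Finset.mem_insert, Finset.mem_Icc]
    omega
  rw [h4, Finset.sum_insert (by simp), Finset.sum_insert (by simp),
    Nat.sub_add_cancel hn] at h3
  have e1 : y + r * (1 - y) = r + y * (1 - r) := by ring
  have e2 : y + (1 - y) = 1 := by ring
  rw [e1, e2] at h3
  simp only [Nat.choose_zero_right, Nat.cast_one, Nat.sub_zero, pow_zero, sub_self, one_pow] at h3
  linarith

/-- Moment duality identity between the simple Λ-asymmetric frequency process and the
asymmetric Eldon–Wakely block counting process: the two generators agree on
`r ↦ r^n` resp. `n ↦ r^n`. -/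
theorem stmt10 (z v1 v2 y1 y2 : ℝ) (hz : 0 < z) (hv1 : 0 < v1) (hv2 : 0 < v2)
    (hy1 : y1 ∈ Set.Ioo (0:ℝ) 1) (hy2 : y2 ∈ Set.Ioo (0:ℝ) 1)
    (n : ℕ) (hn : 1 ≤ n) (r : ℝ) (hr : r ∈ Set.Icc (0:ℝ) 1) :
    z * v1 * r * ((r + y1 * (1 - r)) ^ n - r ^ n)
      + z * v2 * (1 - r) * ((r - y2 * r) ^ n - r ^ n) =
    z * v1 * (∑ k ∈ Finset.Icc 2 n,
        (n.choose k : ℝ) * (1 - y1) ^ (n - k) * y1 ^ k * (r ^ (n - k + 1) - r ^ n))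
      + z * (v2 * (1 - (1 - y2) ^ n) - v1 * (1 - (1 - y1) ^ n)) *
        (r ^ (n + 1) - r ^ n) := by
  rw [stmt10_aux y1 r n hn]
  have e : r - y2 * r = r * (1 - y2) := by ring
  rw [e, mul_pow]
  ring
end

section
/- Let z>0. For i=1,2 let c_i ≥ 0 and let ν_i be a Lévy measure on (0,∞), and let Λ_i be the measure on [0,1] given by Λ_i = (c_i/z)·δ₀ + the measure with density y ↦ z y² with respect to the pushforward of ν_i under the map T_z(w)=w/(w+z); that is, Λ_i(A) = (c_i/z)·δ₀(A) + ∫_A z y² d((T_z)_*ν_i)(y) for Borel A ⊆ [0,1]. If Λ₁ = Λ₂, then c₁ = c₂ and ν₁ = ν₂. In other words, the map H^{(z)} sending (c,ν) to (c/z)δ₀ + z y²·(T_z)_*ν is injective. -/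
open MeasureTheory Set

theorem stmt11_recover (z : ℝ) (hz : 0 < z) (a : ENNReal) (ν : Measure ℝ)
    (hs : ν (Ioi (0:ℝ))ᶜ = 0) :
    Measure.map (fun y => z * y / (1 - y))
      (((a • Measure.dirac (0:ℝ) + (Measure.map (fun w => w / (w + z)) ν).withDensity
        (fun y => ENNReal.ofReal (z * y ^ 2))).restrict (Ioi 0)).withDensity
        (fun y => (ENNReal.ofReal (z * y ^ 2))⁻¹)) = ν := by
  have hT : Measurable (fun w : ℝ => w / (w + z)) := by fun_prop
  have hS : Measurable (fun y : ℝ => z * y / (1 - y)) := by fun_prop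
  have hpos : ∀ᵐ w ∂ν, 0 < w := by
    rw [ae_iff]
    have he : {a : ℝ | ¬ 0 < a} = (Ioi 0)ᶜ := by ext x; simp
    rw [he]; exact hs
  have hpos2 : ∀ᵐ y ∂(Measure.map (fun w => w / (w + z)) ν), y ∈ Ioi (0:ℝ) := by
    refine (ae_map_iff hT.aemeasurable measurableSet_Ioi).2 ?_
    filter_upwards [hpos] with w hw
    exact div_pos hw (by linarith)
  have hd : (Measure.dirac (0:ℝ)).restrict (Ioi 0) = 0 := by
    rw [Measure.restrict_eq_zero]; simp
  rw [Measure.restrict_add, Measure.restrict_smul, hd,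
    restrict_withDensity measurableSet_Ioi, Measure.restrict_eq_self_of_ae_mem hpos2]
  simp only [smul_zero, zero_add]
  rw [withDensity_inv_same₀ (by fun_prop) _ (by simp), Measure.map_map hS hT]
  · conv_rhs => rw [← Measure.map_id (μ := ν)]
    apply Measure.map_congr
    filter_upwards [hpos] with w hw
    have h1 : w + z ≠ 0 := by linarith
    have h2 : 1 - w / (w + z) = z / (w + z) := by field_simp; ring
    simp only [Function.comp, id, h2]
    field_simp
  · filter_upwards [hpos2] with y hy
    have : (0:ℝ) < y := hy
    simp only [ne_eq, ENNReal.ofReal_eq_zero, not_le]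
    positivity

theorem stmt11_atom (z : ℝ) (a : ENNReal) (μ : Measure ℝ) :
    (a • Measure.dirac (0:ℝ) + μ.withDensity
        (fun y => ENNReal.ofReal (z * y ^ 2))) {0} = a := by
  simp [withDensity_apply _ (measurableSet_singleton (0:ℝ))]

/-- Injectivity of the map `H^{(z)}` sending a CB characteristic pair `(c, ν)` to the
characteristic measure of its associated Λ-coalescent,
`Λ = (c/z)·δ₀ + z y² · (T_z)_* ν` with `T_z(w) = w/(w+z)`. -/
theorem stmt11 (z : ℝ) (hz : 0 < z) (c1 c2 : ℝ) (hc1 : 0 ≤ c1) (hc2 : 0 ≤ c2)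
    (ν1 ν2 : Measure ℝ)
    (hν1supp : ν1 (Ioi (0:ℝ))ᶜ = 0) (hν2supp : ν2 (Ioi (0:ℝ))ᶜ = 0)
    (hν1 : ∫⁻ w in Ioi (0:ℝ), ENNReal.ofReal (min 1 (w^2)) ∂ν1 < ⊤)
    (hν2 : ∫⁻ w in Ioi (0:ℝ), ENNReal.ofReal (min 1 (w^2)) ∂ν2 < ⊤)
    (Λ1 Λ2 : Measure ℝ)
    (hΛ1 : Λ1 = ENNReal.ofReal (c1 / z) • Measure.dirac (0:ℝ) +
      (Measure.map (fun w => w / (w + z)) ν1).withDensity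
        (fun y => ENNReal.ofReal (z * y ^ 2)))
    (hΛ2 : Λ2 = ENNReal.ofReal (c2 / z) • Measure.dirac (0:ℝ) +
      (Measure.map (fun w => w / (w + z)) ν2).withDensity
        (fun y => ENNReal.ofReal (z * y ^ 2)))
    (h : Λ1 = Λ2) : c1 = c2 ∧ ν1 = ν2 := by
  subst hΛ1 hΛ2
  constructor
  · have h0 := congrArg (fun μ : Measure ℝ => μ {0}) h
    simp only [stmt11_atom] at h0
    rw [ENNReal.ofReal_eq_ofReal_iff (by positivity) (by positivity)] at h0
    field_simp at h0
    exact h0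
  · rw [← stmt11_recover z hz (ENNReal.ofReal (c1 / z)) ν1 hν1supp, h,
      stmt11_recover z hz (ENNReal.ofReal (c2 / z)) ν2 hν2supp]
end

section
/- Let z>0 and let Λ be a finite measure on [0,1] with Λ({1})=0. Set c = z·Λ({0}) and let ν be the measure on (0,∞) obtained as the pushforward under the map S_z(y)=zy/(1−y) of the measure on (0,1) with density y ↦ 1/(z y²) with respect to the restriction of Λ to (0,1). Then ν is a Lévy measure, i.e. ∫_{(0,∞)} (1 ∧ w²) ν(dw) < ∞, and (c/z)·δ₀ + the measure with density y ↦ z y² with respect to the pushforward of ν under T_z(w)=w/(w+z) equals Λ. In other words, the map H^{(z)}: (c,ν) ↦ (c/z)δ₀ + z y²·(T_z)_*ν is surjective onto the finite measures on [0,1] with no atom at 1, with inverse given by the above formulas. -/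
open MeasureTheory Set

/-- Surjectivity of the map `H^{(z)} : (c, ν) ↦ (c/z)·δ₀ + z y² · (T_z)_* ν` onto the
finite measures on `[0,1]` with no atom at `1`, with the explicit inverse
`c = z·Λ({0})`, `ν = (S_z)_* ( (z y²)⁻¹ · Λ|_{(0,1)} )` where `S_z(y) = z y/(1-y)`. -/
theorem stmt12 (z : ℝ) (hz : 0 < z) (Λ : Measure ℝ) [IsFiniteMeasure Λ]
    (hsupp : Λ (Icc (0:ℝ) 1)ᶜ = 0) (hone : Λ {(1:ℝ)} = 0)
    (c : ℝ) (hc : c = z * (Λ {(0:ℝ)}).toReal)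
    (ν : Measure ℝ)
    (hν : ν = Measure.map (fun y => z * y / (1 - y))
      ((Λ.restrict (Ioo (0:ℝ) 1)).withDensity
        (fun y => ENNReal.ofReal (1 / (z * y ^ 2))))) :
    (∫⁻ w in Ioi (0:ℝ), ENNReal.ofReal (min 1 (w^2)) ∂ν < ⊤) ∧
    ENNReal.ofReal (c / z) • Measure.dirac (0:ℝ) +
      (Measure.map (fun w => w / (w + z)) ν).withDensity
        (fun y => ENNReal.ofReal (z * y ^ 2)) = Λ := by
  have mS : Measurable (fun y : ℝ => z * y / (1 - y)) := by fun_prop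
  have mT : Measurable (fun w : ℝ => w / (w + z)) := by fun_prop
  have mD : Measurable (fun y : ℝ => ENNReal.ofReal (1 / (z * y ^ 2))) := by fun_prop
  have mE : Measurable (fun y : ℝ => ENNReal.ofReal (z * y ^ 2)) := by fun_prop
  have key : ∀ g : ℝ → ENNReal, Measurable g →
      ∫⁻ w, g w ∂ν = ∫⁻ y in Ioo (0:ℝ) 1,
        ENNReal.ofReal (1 / (z * y ^ 2)) * g (z * y / (1 - y)) ∂Λ := by
    intro g hg
    rw [hν, lintegral_map hg mS]
    exact lintegral_withDensity_eq_lintegral_mul _ mD (hg.comp mS)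
  constructor
  · have mM : Measurable (fun w : ℝ => ENNReal.ofReal (min 1 (w^2))) := by fun_prop
    refine lt_of_le_of_lt (setLIntegral_le_lintegral _ _) ?_
    rw [key _ mM]
    refine lt_of_le_of_lt (setLIntegral_mono (g := fun _ => ENNReal.ofReal (4 * z + 4 / z))
      measurable_const ?_) ?_
    · intro y hy
      obtain ⟨h0, h1⟩ := hy
      have h1' : 0 < 1 - y := by linarith
      rw [← ENNReal.ofReal_mul (by positivity)]
      apply ENNReal.ofReal_le_ofReal
      rcases le_total y (1/2) with h | h
      · calc 1 / (z * y ^ 2) * min 1 ((z * y / (1 - y)) ^ 2)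
            ≤ 1 / (z * y ^ 2) * (z * y / (1 - y)) ^ 2 := by
              gcongr; exact min_le_right _ _
          _ = z / (1 - y) ^ 2 := by field_simp
          _ ≤ 4 * z := by
              rw [div_le_iff₀ (by positivity)]
              have : 1 ≤ 4 * (1 - y) ^ 2 := by nlinarith
              nlinarith
          _ ≤ 4 * z + 4 / z := by
              have : 0 < 4 / z := by positivity
              linarith
      · calc 1 / (z * y ^ 2) * min 1 ((z * y / (1 - y)) ^ 2)
            ≤ 1 / (z * y ^ 2) * 1 := by
              gcongr; exact min_le_left _ _
          _ ≤ 4 / z := by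
              rw [mul_one, div_le_div_iff₀ (by positivity) hz]
              have : 1 ≤ 4 * y ^ 2 := by nlinarith
              nlinarith
          _ ≤ 4 * z + 4 / z := by
              have : 0 < 4 * z := by positivity
              linarith
    · rw [setLIntegral_const]
      exact ENNReal.mul_lt_top ENNReal.ofReal_lt_top (measure_lt_top _ _)
  · have hczz : ENNReal.ofReal (c / z) = Λ {(0:ℝ)} := by
      rw [hc, mul_div_cancel_left₀ _ hz.ne', ENNReal.ofReal_toReal (measure_ne_top _ _)]
    have h2 : (Measure.map (fun w => w / (w + z)) ν).withDensity
        (fun y => ENNReal.ofReal (z * y ^ 2)) = Λ.restrict (Ioo (0:ℝ) 1) := by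
      ext s hs
      rw [withDensity_apply _ hs, ← lintegral_indicator hs,
        lintegral_map (mE.indicator hs) mT, key (fun a => s.indicator (fun y => ENNReal.ofReal (z * y ^ 2)) (a / (a + z)))
          ((mE.indicator hs).comp mT),
        ← lintegral_indicator_one hs]
      apply setLIntegral_congr_fun measurableSet_Ioo
      intro y hy
      obtain ⟨h0, h1⟩ := hy
      have h1' : 1 - y ≠ 0 := by linarith
      have e : (z * y / (1 - y)) / (z * y / (1 - y) + z) = y := by
        have : z * y / (1 - y) + z = z / (1 - y) := by field_simp; ring
        rw [this]; field_simp
      simp only [e]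
      by_cases hys : y ∈ s
      · simp only [indicator_of_mem hys, Pi.one_apply]
        rw [← ENNReal.ofReal_mul (by positivity), one_div_mul_cancel (by positivity),
          ENNReal.ofReal_one]
      · simp [indicator_of_notMem hys]
    rw [hczz, h2, ← Measure.restrict_singleton,
      ← Measure.restrict_union (by simp) measurableSet_Ioo]
    apply Measure.restrict_eq_self_of_ae_mem
    have a1 : ∀ᵐ x ∂Λ, x ∈ Icc (0:ℝ) 1 := hsupp
    have a2 : ∀ᵐ x ∂Λ, x ≠ 1 := by
      rw [ae_iff]; simpa using hone
    filter_upwards [a1, a2] with x hx hx1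
    rcases hx.1.eq_or_lt with h | h
    · left; exact h.symm
    · right; exact ⟨h, lt_of_le_of_ne hx.2 hx1⟩
end

section
/- Let m be a measure on (0,∞) with ∫_{(0,∞)} w² m(dw) < ∞ and let θ∈ℝ. Then lim_{z→∞} z · ∫_{(0,∞)} ( 1 − exp( iθ w√z/(z+w) ) + iθ w√z/(z+w) ) m(dw) = (θ²/2) · ∫_{(0,∞)} w² m(dw), where the integral on the left is a complex-valued integral and i is the imaginary unit. -/
open MeasureTheory Set Filter

lemma aux_bound (x : ℝ) :
    ‖1 - Complex.exp (Complex.I * (x : ℂ)) + Complex.I * (x : ℂ)‖ ≤ 3 * x ^ 2 := by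
  have e : 1 - Complex.exp (Complex.I * (x : ℂ)) + Complex.I * (x : ℂ)
      = -(Complex.exp (Complex.I * (x : ℂ)) - 1 - Complex.I * (x : ℂ)) := by ring
  have hn : ‖Complex.I * (x : ℂ)‖ = |x| := by simp
  rw [e, norm_neg]
  rcases le_total |x| 1 with h | h
  · have := Complex.norm_exp_sub_one_sub_id_le (x := Complex.I * (x : ℂ)) (by rw [hn]; exact h)
    rw [hn, sq_abs] at this
    nlinarith [sq_nonneg x]
  · have h1 := norm_sub_le (Complex.exp (Complex.I * (x : ℂ)) - 1) (Complex.I * (x : ℂ))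
    have h2 := Real.norm_exp_I_mul_ofReal_sub_one_le (x := x)
    rw [Real.norm_eq_abs] at h2
    rw [hn] at h1
    nlinarith [sq_abs x]

lemma aux_bound3 (x : ℝ) :
    ‖1 - Complex.exp (Complex.I * (x : ℂ)) + Complex.I * (x : ℂ) - ((x ^ 2 / 2 : ℝ) : ℂ)‖
      ≤ x ^ 2 * (|x| * Real.exp |x|) := by
  have h := Complex.norm_exp_sub_sum_le_norm_mul_exp (Complex.I * (x : ℂ)) 3
  have hn : ‖Complex.I * (x : ℂ)‖ = |x| := by simp
  rw [hn] at h
  rw [← norm_neg]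
  convert h using 1
  · congr 1
    simp [Finset.sum_range_succ, Nat.factorial, mul_pow]
    ring
  · rw [← sq_abs x]; ring

lemma aux_ratio (w : ℝ) : Tendsto (fun z : ℝ => z / (z + w)) atTop (nhds 1) := by
  have h : Tendsto (fun z : ℝ => 1 - w / (z + w)) atTop (nhds (1 - 0)) :=
    tendsto_const_nhds.sub (tendsto_const_nhds.div_atTop (tendsto_atTop_add_const_right _ _ tendsto_id))
  rw [sub_zero] at h
  refine h.congr' ?_
  filter_upwards [eventually_gt_atTop (-w)] with z hz
  have : z + w ≠ 0 := by linarith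
  field_simp
  ring

lemma aux_sq (θ w z : ℝ) (hz : 0 ≤ z) :
    z * (θ * (w * Real.sqrt z / (z + w))) ^ 2 = θ ^ 2 * w ^ 2 * (z / (z + w)) ^ 2 := by
  have : Real.sqrt z ^ 2 = z := Real.sq_sqrt hz
  simp only [mul_pow, div_pow, this]
  ring

lemma aux_x (θ w : ℝ) :
    Tendsto (fun z : ℝ => θ * (w * Real.sqrt z / (z + w))) atTop (nhds 0) := by
  have h : Tendsto (fun z : ℝ => θ * w * (z / (z + w)) * (Real.sqrt z)⁻¹) atTop
      (nhds (θ * w * 1 * 0)) :=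
    (tendsto_const_nhds.mul (aux_ratio w)).mul
      (tendsto_inv_atTop_zero.comp Real.tendsto_sqrt_atTop)
  rw [mul_zero] at h
  refine h.congr' ?_
  filter_upwards [eventually_gt_atTop 0] with z hz
  have h1 : Real.sqrt z ≠ 0 := (Real.sqrt_pos.2 hz).ne'
  have h2 : z * (Real.sqrt z)⁻¹ = Real.sqrt z := by
    rw [← div_eq_mul_inv, Real.div_sqrt]
  calc _ = θ * (w * (z * (Real.sqrt z)⁻¹) / (z + w)) := by ring
    _ = _ := by rw [h2]

lemma aux_pt (θ w : ℝ) :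
    Tendsto (fun z : ℝ => (z : ℂ) *
        (1 - Complex.exp (Complex.I * ((θ * (w * Real.sqrt z / (z + w)) : ℝ) : ℂ)) +
          Complex.I * ((θ * (w * Real.sqrt z / (z + w)) : ℝ) : ℂ)))
      atTop (nhds ((θ ^ 2 / 2 * w ^ 2 : ℝ) : ℂ)) := by
  have hx := aux_x θ w
  have hq : Tendsto (fun z : ℝ => z * (θ * (w * Real.sqrt z / (z + w))) ^ 2) atTop
      (nhds (θ ^ 2 * w ^ 2)) := by
    have h : Tendsto (fun z : ℝ => θ ^ 2 * w ^ 2 * (z / (z + w)) ^ 2) atTop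
      (nhds (θ ^ 2 * w ^ 2 * 1 ^ 2)) := tendsto_const_nhds.mul ((aux_ratio w).pow 2)
    rw [one_pow, mul_one] at h
    refine h.congr' ?_
    filter_upwards [eventually_ge_atTop 0] with z hz
    rw [aux_sq θ w z hz]
  have hmain : Tendsto (fun z : ℝ =>
      ((z * (θ * (w * Real.sqrt z / (z + w))) ^ 2 / 2 : ℝ) : ℂ)) atTop
      (nhds ((θ ^ 2 / 2 * w ^ 2 : ℝ) : ℂ)) := by
    refine (Complex.continuous_ofReal.tendsto _).comp ?_
    convert hq.div_const 2 using 2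
    ring
  have hx' := hx.abs
  rw [abs_zero] at hx'
  have herr := hq.mul (hx'.mul ((Real.continuous_exp.tendsto _).comp hx'))
  rw [zero_mul, mul_zero] at herr
  have hdiff : Tendsto (fun z : ℝ => (z : ℂ) *
        (1 - Complex.exp (Complex.I * ((θ * (w * Real.sqrt z / (z + w)) : ℝ) : ℂ)) +
          Complex.I * ((θ * (w * Real.sqrt z / (z + w)) : ℝ) : ℂ)
          - (((θ * (w * Real.sqrt z / (z + w))) ^ 2 / 2 : ℝ) : ℂ))) atTop (nhds 0) := by
    refine squeeze_zero_norm' ?_ herr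
    filter_upwards [eventually_ge_atTop 0] with z hz
    rw [norm_mul, Complex.norm_real, Real.norm_of_nonneg hz, mul_assoc]
    exact mul_le_mul_of_nonneg_left (aux_bound3 _) hz
  have := hdiff.add hmain
  rw [zero_add] at this
  refine this.congr fun z => ?_
  push_cast
  ring

/-- Limit of the jump part of the log-characteristic function of the rescaled
fluctuations of the Λ-asymmetric frequency process: for a measure `m` on `(0,∞)` with
finite second moment,
`z ∫ (1 - exp(iθw√z/(z+w)) + iθw√z/(z+w)) m(dw) → (θ²/2) ∫ w² m(dw)` as `z → ∞`. -/
theorem stmt14 (m : Measure ℝ) (hsupp : m (Ioi (0:ℝ))ᶜ = 0)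
    (hm : ∫⁻ w in Ioi (0:ℝ), ENNReal.ofReal (w ^ 2) ∂m < ⊤) (θ : ℝ) :
    Tendsto
      (fun z : ℝ => (z : ℂ) * ∫ w in Ioi (0:ℝ),
        (1 - Complex.exp (Complex.I * ((θ * (w * Real.sqrt z / (z + w)) : ℝ) : ℂ)) +
          Complex.I * ((θ * (w * Real.sqrt z / (z + w)) : ℝ) : ℂ)) ∂m)
      atTop
      (nhds (((θ ^ 2 / 2 * ∫ w in Ioi (0:ℝ), w ^ 2 ∂m : ℝ) : ℂ))) := by
  have hint : Integrable (fun w : ℝ => w ^ 2) (m.restrict (Ioi 0)) := by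
    refine ⟨by fun_prop, ?_⟩
    rw [hasFiniteIntegral_iff_ofReal (Eventually.of_forall fun w => sq_nonneg w)]
    exact hm
  simp_rw [← integral_const_mul]
  rw [← integral_complex_ofReal]
  refine tendsto_integral_filter_of_dominated_convergence
    (fun w => 3 * θ ^ 2 * w ^ 2) ?_ ?_ (hint.const_mul _) ?_
  · refine Eventually.of_forall fun z => Measurable.aestronglyMeasurable ?_
    fun_prop
  · filter_upwards [eventually_gt_atTop 0] with z hz
    filter_upwards [ae_restrict_mem measurableSet_Ioi] with w hw
    have hw : 0 < w := hw
    rw [norm_mul, Complex.norm_real, Real.norm_of_nonneg hz.le]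
    have h1 := mul_le_mul_of_nonneg_left (aux_bound (θ * (w * Real.sqrt z / (z + w)))) hz.le
    have h2 := aux_sq θ w z hz.le
    have h3 : (z / (z + w)) ^ 2 ≤ 1 :=
      pow_le_one₀ (by positivity) ((div_le_one (by positivity)).2 (by linarith))
    have h4 := mul_le_mul_of_nonneg_left h3 (by positivity : 0 ≤ θ ^ 2 * w ^ 2)
    refine h1.trans ?_
    linarith
  · exact Eventually.of_forall fun w => aux_pt θ w
end

section
/- Let z>0 and let μ be a measure on (0,1) with ∫_{(0,1)} u² μ(du) < ∞ and μ([1/(1+z),1)) < ∞. For integers n ≥ 1 and r∈[0,1]: z r ∫_{(0,1)} [ (r(1−u)+u)^n − r^n − (u/(1−u))·n r^{n−1}(1−r)·1_{u < 1/(1+z)} ] μ(du) = Σ_{k=2}^{n} C(n,k)·z·λ_{n,k}(1)·(r^{n+1−k} − r^n) + (r^{n+1} − r^n)·[ Σ_{k=2}^{n} C(n,k)·z·( k·λ_{n,k}(1/(1+z)) − λ_{n,k}(1) ) + z n ∫_{(0,1/(1+z))} u²/(1−u) μ(du) − n z ∫_{[1/(1+z),1)} (1−u)^{n−1} u μ(du)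 ], where all integrals on both sides are finite. -/
open MeasureTheory Set Finset

lemma sum_split_two (n : ℕ) (hn : 1 ≤ n) (f : ℕ → ℝ) :
    ∑ k ∈ Finset.range (n + 1), f k = f 0 + f 1 + ∑ k ∈ Finset.Icc 2 n, f k := by
  have h : Finset.Icc 2 n = Finset.Ico 2 (n + 1) := by
    ext x; simp only [Finset.mem_Icc, Finset.mem_Ico]; omega
  rw [h, Finset.range_eq_Ico, Finset.sum_eq_sum_Ico_succ_bot (by omega),
    Finset.sum_eq_sum_Ico_succ_bot (by omega)]
  ring

lemma binom_mean (n : ℕ) (hn : 1 ≤ n) (u : ℝ) :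
    ∑ k ∈ Finset.Icc 2 n, (k : ℝ) * ((n.choose k : ℝ) * ((1 - u) ^ (n - k) * u ^ k))
      = n * u - n * ((1 - u) ^ (n - 1) * u) := by
  have h := congrArg (Polynomial.eval u) (bernsteinPolynomial.sum_smul ℝ n)
  rw [Polynomial.eval_finsetSum, sum_split_two n hn] at h
  simp [bernsteinPolynomial] at h
  rw [Finset.sum_congr rfl (g := fun k : ℕ =>
    (k : ℝ) * ((n.choose k : ℝ) * u ^ k * (1 - u) ^ (n - k)))]
  · linarith
  · intros; ring

lemma binom_gen (n : ℕ) (hn : 1 ≤ n) (u r : ℝ) :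
    ∑ k ∈ Finset.Icc 2 n, (n.choose k : ℝ) * ((1 - u) ^ (n - k) * u ^ k) * (r ^ (n - k) - r ^ n)
      = (r * (1 - u) + u) ^ n - r ^ n - n * ((1 - u) ^ (n - 1) * u) * (r ^ (n - 1) - r ^ n) := by
  have h1 := add_pow u (r * (1 - u)) n
  have h2 := add_pow u (1 - u) n
  rw [sum_split_two n hn] at h1 h2
  simp only [mul_sub, Finset.sum_sub_distrib]
  have e1 : ∑ k ∈ Finset.Icc 2 n, (n.choose k : ℝ) * ((1 - u) ^ (n - k) * u ^ k) * r ^ (n - k)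
      = ∑ k ∈ Finset.Icc 2 n, u ^ k * (r * (1 - u)) ^ (n - k) * (n.choose k : ℝ) := by
    refine Finset.sum_congr rfl fun k _ => ?_
    rw [mul_pow]; ring
  have e2 : ∑ k ∈ Finset.Icc 2 n, (n.choose k : ℝ) * ((1 - u) ^ (n - k) * u ^ k) * r ^ n
      = r ^ n * ∑ k ∈ Finset.Icc 2 n, u ^ k * (1 - u) ^ (n - k) * (n.choose k : ℝ) := by
    rw [Finset.mul_sum]
    refine Finset.sum_congr rfl fun k _ => ?_
    ring
  rw [e1, e2]
  simp [mul_pow] at h1 h2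
  simp only [mul_pow]
  rw [show r * 1 - r * u + u = u + r * (1 - u) by ring, h1]
  linear_combination r ^ n * h2

lemma pointwise (v : ℝ) (n : ℕ) (hn : 1 ≤ n) (r u : ℝ) (hu : u ∈ Ioo (0:ℝ) 1) :
    (r * (1 - u) + u) ^ n - r ^ n -
        (u / (1 - u)) * n * r ^ (n - 1) * (1 - r) * (if u < v then (1:ℝ) else 0)
    = (∑ k ∈ Finset.Icc 2 n, ((n.choose k : ℝ) * (r ^ (n - k) - r ^ n)) *
          ((1 - u) ^ (n - k) * u ^ k))
      - (∑ k ∈ Finset.Icc 2 n, (r ^ (n - 1) * (1 - r) * k * (n.choose k : ℝ)) *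
          (Ioo 0 v).indicator (fun u => (1 - u) ^ (n - k) * u ^ k) u)
      - (r ^ (n - 1) * (1 - r) * n) * (Ioo 0 v).indicator (fun u => u ^ 2 / (1 - u)) u
      + (r ^ (n - 1) * (1 - r) * n) *
          (Ico v 1).indicator (fun u => (1 - u) ^ (n - 1) * u) u := by
  have hg := binom_gen n hn u r
  have hm := binom_mean n hn u
  have hrn : r ^ n = r ^ (n - 1) * r := by rw [← pow_succ]; congr 1; omega
  rw [Finset.sum_congr rfl (g := fun k : ℕ => (n.choose k : ℝ) * ((1 - u) ^ (n - k) * u ^ k) *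
    (r ^ (n - k) - r ^ n)) (by intros; ring), hg]
  have h1u : (1 - u) ≠ 0 := by have := hu.2; intro h; linarith
  by_cases huv : u < v
  · have m1 : u ∈ Ioo 0 v := ⟨hu.1, huv⟩
    have m2 : u ∉ Ico v 1 := fun h => absurd huv (not_lt.2 h.1)
    simp only [Set.indicator_of_mem m1, Set.indicator_of_notMem m2, if_pos huv]
    rw [Finset.sum_congr rfl (g := fun k : ℕ => (r ^ (n - 1) * (1 - r)) *
      ((k : ℝ) * ((n.choose k : ℝ) * ((1 - u) ^ (n - k) * u ^ k)))) (by intros; ring),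
      ← Finset.mul_sum, hm, hrn]
    field_simp
    ring
  · have m1 : u ∉ Ioo 0 v := fun h => huv h.2
    have m2 : u ∈ Ico v 1 := ⟨not_lt.1 huv, hu.2⟩
    simp only [Set.indicator_of_notMem m1, Set.indicator_of_mem m2, if_neg huv]
    rw [hrn]
    simp
    ring

/-- Contribution of the first population's jump measure (pushed forward to `(0,1)`) to the
generator of the Λ-asymmetric frequency process applied to `H(n,r) = r^n`:
all the integrals involved are finite and the generator term decomposes into coalescence,
frequency-dependent variance and selection terms of the moment dual. -/
theorem stmt15 (z : ℝ) (hz : 0 < z) (μ : Measure ℝ)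
    (hμsupp : μ (Ioo (0:ℝ) 1)ᶜ = 0)
    (hμ2 : ∫⁻ u in Ioo (0:ℝ) 1, ENNReal.ofReal (u ^ 2) ∂μ < ⊤)
    (hμfin : μ (Ico (1 / (1 + z)) 1) < ⊤)
    (n : ℕ) (hn : 1 ≤ n) (r : ℝ) (hr : r ∈ Icc (0:ℝ) 1) :
    IntegrableOn (fun u => (r * (1 - u) + u) ^ n - r ^ n -
        (u / (1 - u)) * n * r ^ (n - 1) * (1 - r) *
          (if u < 1 / (1 + z) then (1:ℝ) else 0)) (Ioo (0:ℝ) 1) μ ∧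
    (∀ k, 2 ≤ k → k ≤ n →
      IntegrableOn (fun u => (1 - u) ^ (n - k) * u ^ k) (Ioo (0:ℝ) 1) μ) ∧
    IntegrableOn (fun u => u ^ 2 / (1 - u)) (Ioo (0:ℝ) (1 / (1 + z))) μ ∧
    IntegrableOn (fun u => (1 - u) ^ (n - 1) * u) (Ico (1 / (1 + z)) 1) μ ∧
    z * r * (∫ u in Ioo (0:ℝ) 1, ((r * (1 - u) + u) ^ n - r ^ n -
        (u / (1 - u)) * n * r ^ (n - 1) * (1 - r) *
          (if u < 1 / (1 + z) then (1:ℝ) else 0)) ∂μ) =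
      (∑ k ∈ Finset.Icc 2 n, (n.choose k : ℝ) * z *
          (∫ u in Ioo (0:ℝ) 1, (1 - u) ^ (n - k) * u ^ k ∂μ) *
          (r ^ (n + 1 - k) - r ^ n))
      + (r ^ (n + 1) - r ^ n) *
        ((∑ k ∈ Finset.Icc 2 n, (n.choose k : ℝ) * z *
            ((k : ℝ) * (∫ u in Ioo (0:ℝ) (1 / (1 + z)), (1 - u) ^ (n - k) * u ^ k ∂μ)
              - ∫ u in Ioo (0:ℝ) 1, (1 - u) ^ (n - k) * u ^ k ∂μ))
          + z * n * (∫ u in Ioo (0:ℝ) (1 / (1 + z)), u ^ 2 / (1 - u) ∂μ)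
          - n * z * (∫ u in Ico (1 / (1 + z)) 1, (1 - u) ^ (n - 1) * u ∂μ)) := by
  have hv0 : 0 < 1 / (1 + z) := by positivity
  have hv1 : 1 / (1 + z) < 1 := by rw [div_lt_one (by positivity)]; linarith
  have hpw := pointwise (1 / (1 + z)) n hn r
  set v := 1 / (1 + z) with hv
  have hsq : IntegrableOn (fun u : ℝ => u ^ 2) (Ioo (0:ℝ) 1) μ := by
    refine ⟨by fun_prop, ?_⟩
    rw [hasFiniteIntegral_iff_ofReal (Filter.Eventually.of_forall fun u => sq_nonneg u)]
    exact hμ2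
  have hsub1 : Ioo 0 v ⊆ Ioo (0:ℝ) 1 := Ioo_subset_Ioo_right hv1.le
  have hsub2 : Ico v 1 ⊆ Ioo (0:ℝ) 1 := fun x hx => ⟨hv0.trans_le hx.1, hx.2⟩
  have hB : ∀ k, 2 ≤ k → k ≤ n →
      IntegrableOn (fun u : ℝ => (1 - u) ^ (n - k) * u ^ k) (Ioo (0:ℝ) 1) μ := by
    intro k hk _
    refine Integrable.mono' hsq (by fun_prop) ?_
    refine (ae_restrict_iff' measurableSet_Ioo).2 (Filter.Eventually.of_forall fun u hu => ?_)
    have h0 : 0 ≤ 1 - u := by linarith [hu.2]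
    have h1 : (1 - u) ^ (n - k) ≤ 1 := pow_le_one₀ h0 (by linarith [hu.1])
    have h2 : u ^ k ≤ u ^ 2 := pow_le_pow_of_le_one hu.1.le hu.2.le hk
    have h3 : 0 ≤ u ^ k := pow_nonneg hu.1.le k
    rw [Real.norm_of_nonneg (mul_nonneg (pow_nonneg h0 _) h3)]
    nlinarith
  have hC : IntegrableOn (fun u : ℝ => u ^ 2 / (1 - u)) (Ioo (0:ℝ) v) μ := by
    refine Integrable.mono' ((hsq.mono_set hsub1).mul_const (1 / (1 - v)))
      (Measurable.aestronglyMeasurable (by fun_prop)) ?_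
    refine (ae_restrict_iff' measurableSet_Ioo).2 (Filter.Eventually.of_forall fun u hu => ?_)
    have h0 : 0 < 1 - v := by linarith
    have h1 : 1 - v ≤ 1 - u := by linarith [hu.2]
    rw [Real.norm_of_nonneg (div_nonneg (sq_nonneg u) (h0.le.trans h1)), mul_one_div]
    gcongr
  have hD : IntegrableOn (fun u : ℝ => (1 - u) ^ (n - 1) * u) (Ico v 1) μ := by
    have : IntegrableOn (fun _ : ℝ => (1:ℝ)) (Ico v 1) μ := integrableOn_const hμfin.ne
    refine Integrable.mono' this (by fun_prop) ?_
    refine (ae_restrict_iff' measurableSet_Ico).2 (Filter.Eventually.of_forall fun u hu => ?_)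
    have hp : 0 ≤ u := hv0.le.trans hu.1
    have h0 : 0 ≤ 1 - u := by linarith [hu.2]
    have h1 : (1 - u) ^ (n - 1) ≤ 1 := pow_le_one₀ h0 (by linarith)
    rw [Real.norm_of_nonneg (mul_nonneg (pow_nonneg h0 _) hp)]
    nlinarith [hu.2]
  -- indicator versions
  have key1 : ∀ g : ℝ → ℝ, IntegrableOn g (Ioo 0 v) μ →
      IntegrableOn ((Ioo 0 v).indicator g) (Ioo (0:ℝ) 1) μ := fun g hg =>
    ((integrable_indicator_iff measurableSet_Ioo).2 hg).integrableOn
  have key2 : ∀ g : ℝ → ℝ, ∫ u in Ioo (0:ℝ) 1, (Ioo 0 v).indicator g u ∂μ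
      = ∫ u in Ioo 0 v, g u ∂μ := fun g => by
    rw [setIntegral_indicator measurableSet_Ioo, Set.inter_eq_right.2 hsub1]
  have hDi : IntegrableOn ((Ico v 1).indicator (fun u : ℝ => (1 - u) ^ (n - 1) * u))
      (Ioo (0:ℝ) 1) μ := ((integrable_indicator_iff measurableSet_Ico).2 hD).integrableOn
  have hDe : ∫ u in Ioo (0:ℝ) 1, (Ico v 1).indicator (fun u : ℝ => (1 - u) ^ (n - 1) * u) u ∂μ
      = ∫ u in Ico v 1, (1 - u) ^ (n - 1) * u ∂μ := by
    rw [setIntegral_indicator measurableSet_Ico, Set.inter_eq_right.2 hsub2]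
  have i1 : ∀ k ∈ Finset.Icc 2 n, Integrable (fun u : ℝ =>
      ((n.choose k : ℝ) * (r ^ (n - k) - r ^ n)) * ((1 - u) ^ (n - k) * u ^ k))
      (μ.restrict (Ioo 0 1)) := fun k hk =>
    Integrable.const_mul (hB k (Finset.mem_Icc.1 hk).1 (Finset.mem_Icc.1 hk).2) _
  have i2 : ∀ k ∈ Finset.Icc 2 n, Integrable (fun u : ℝ =>
      (r ^ (n - 1) * (1 - r) * k * (n.choose k : ℝ)) *
          (Ioo 0 v).indicator (fun u => (1 - u) ^ (n - k) * u ^ k) u)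
      (μ.restrict (Ioo 0 1)) := fun k hk =>
    Integrable.const_mul (key1 _ ((hB k (Finset.mem_Icc.1 hk).1
      (Finset.mem_Icc.1 hk).2).mono_set hsub1)) _
  have i3 : Integrable (fun u : ℝ => (r ^ (n - 1) * (1 - r) * n) *
      (Ioo 0 v).indicator (fun u => u ^ 2 / (1 - u)) u) (μ.restrict (Ioo 0 1)) :=
    Integrable.const_mul (key1 _ hC) _
  have i4 : Integrable (fun u : ℝ => (r ^ (n - 1) * (1 - r) * n) *
      (Ico v 1).indicator (fun u => (1 - u) ^ (n - 1) * u) u) (μ.restrict (Ioo 0 1)) :=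
    Integrable.const_mul hDi _
  have j1 := integrable_finsetSum _ i1
  have j2 := integrable_finsetSum _ i2
  have j12 := j1.sub' j2
  have j123 := j12.sub' i3
  have jall := j123.add i4
  refine ⟨?_, hB, hC, hD, ?_⟩
  · exact (integrableOn_congr_fun hpw measurableSet_Ioo).2 jall
  · rw [setIntegral_congr_fun measurableSet_Ioo hpw, integral_add j123 i4, integral_sub j12 i3,
      integral_sub j1 j2, integral_finsetSum _ i1, integral_finsetSum _ i2]
    simp only [integral_const_mul]
    rw [hDe, key2]
    simp only [key2]
    have hrn : r ^ n = r * r ^ (n - 1) := by rw [← pow_succ']; congr 1; omega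
    have hS1 : z * r * ∑ k ∈ Finset.Icc 2 n, ((n.choose k : ℝ) * (r ^ (n - k) - r ^ n)) *
          (∫ u in Ioo (0:ℝ) 1, (1 - u) ^ (n - k) * u ^ k ∂μ)
        = (∑ k ∈ Finset.Icc 2 n, (n.choose k : ℝ) * z *
          (∫ u in Ioo (0:ℝ) 1, (1 - u) ^ (n - k) * u ^ k ∂μ) *
          (r ^ (n + 1 - k) - r ^ n)) - (r ^ (n + 1) - r ^ n) * ∑ k ∈ Finset.Icc 2 n,
          (n.choose k : ℝ) * z * (∫ u in Ioo (0:ℝ) 1, (1 - u) ^ (n - k) * u ^ k ∂μ) := by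
      rw [Finset.mul_sum, Finset.mul_sum, ← Finset.sum_sub_distrib]
      refine Finset.sum_congr rfl fun k hk => ?_
      have : r ^ (n + 1 - k) = r * r ^ (n - k) := by
        rw [← pow_succ']; congr 1; have := (Finset.mem_Icc.1 hk).2; omega
      rw [this]; ring
    have hS2 : z * r * ∑ k ∈ Finset.Icc 2 n, (r ^ (n - 1) * (1 - r) * k * (n.choose k : ℝ)) *
          (∫ u in Ioo (0:ℝ) v, (1 - u) ^ (n - k) * u ^ k ∂μ)
        = - (r ^ (n + 1) - r ^ n) * ∑ k ∈ Finset.Icc 2 n, (n.choose k : ℝ) * z *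
          ((k : ℝ) * (∫ u in Ioo (0:ℝ) v, (1 - u) ^ (n - k) * u ^ k ∂μ)) := by
      rw [Finset.mul_sum, Finset.mul_sum]
      refine Finset.sum_congr rfl fun k hk => ?_
      rw [pow_succ, hrn]; ring
    rw [mul_add, mul_sub, mul_sub, hS1, hS2]
    simp only [mul_sub, Finset.sum_sub_distrib]
    rw [pow_succ, hrn]
    ring
end
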